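/- Let I ⊆ K[X][U] be an ideal, let ≺_σ be an I-specific elimination order for U with σ ∈ int(C_{≺_σ}(I)), let τ ∈ Ω_u, let ω ∈ [σ,τ] with ω ≠ τ, and let ≺_ω be a monomial order with ω ∈ int(C_{≺_ω}(I)). Then L_{X,≺_ω}(GB(I,≺_ω)) = L_{X,≺_σ}(GB(I,≺_σ)); in particular L_{X,≺_ω}(GB(I,≺_ω)) ⊆ K[X], so ≺_ω is itself an I-specific elimination order for U. -/

import Mathlib

open MvPolynomial

/-- A monomial order on exponent vectors in `Fin N →₀ ℕ`:
a linear order compatible with addition in which `0` is the least element. -/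
structure MonoOrder (N : ℕ) where
  lt : (Fin N →₀ ℕ) → (Fin N →₀ ℕ) → Prop
  total : ∀ a b, a = b ∨ lt a b ∨ lt b a
  trans : ∀ a b c, lt a b → lt b c → lt a c
  irrefl : ∀ a, ¬ lt a a
  add_right : ∀ a b c, lt a b → lt (a + c) (b + c)
  zero_lt : ∀ a, a ≠ 0 → lt 0 a

variable {N : ℕ} {K : Type*} [Field K]

/-- The ω-degree `ω · d` of an exponent vector `d`. -/
noncomputable def wdeg (ω : Fin N → ℝ) (d : Fin N → ℕ) : ℝ :=
  ∑ i, ω i * (d i : ℝ)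

/-- The ≺-maximal exponent in the support of `p` (the exponent of the leading term). -/
noncomputable def leadExp (mo : MonoOrder N) (p : MvPolynomial (Fin N) K) : Fin N →₀ ℕ :=
  open Classical in
  if h : ∃ d ∈ p.support, ∀ e ∈ p.support, e ≠ d → mo.lt e d then h.choose else 0

/-- The leading term `lt_≺(p)` of `p` w.r.t. the monomial order `mo`. -/
noncomputable def leadTerm (mo : MonoOrder N) (p : MvPolynomial (Fin N) K) :
    MvPolynomial (Fin N) K :=
  monomial (leadExp mo p) (p.coeff (leadExp mo p))

/-- `p ∈ K[X]`: the polynomial `p` involves only the first `n` variables. -/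
def inKX (n : ℕ) (p : MvPolynomial (Fin N) K) : Prop :=
  ∀ d ∈ p.support, ∀ i : Fin N, n ≤ (i : ℕ) → d i = 0

open Classical in
/-- Initial form `lt_ω(p)`: the sum of the terms of `p` of maximal ω-degree. -/
noncomputable def initForm (ω : Fin N → ℝ) (p : MvPolynomial (Fin N) K) :
    MvPolynomial (Fin N) K :=
  ∑ d ∈ p.support.filter (fun d : Fin N →₀ ℕ => ∀ e ∈ p.support, wdeg ω ⇑e ≤ wdeg ω ⇑d),
    monomial d (p.coeff d)

/-- The initial ideal `⟨lt_ω(I)⟩` w.r.t. a weight vector ω. -/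
noncomputable def ltIdealW (ω : Fin N → ℝ) (I : Ideal (MvPolynomial (Fin N) K)) :
    Ideal (MvPolynomial (Fin N) K) :=
  Ideal.span (initForm ω '' (I : Set (MvPolynomial (Fin N) K)))

/-- The initial ideal `⟨lt_≺(I)⟩` w.r.t. a monomial order. -/
noncomputable def ltIdealO (mo : MonoOrder N) (I : Ideal (MvPolynomial (Fin N) K)) :
    Ideal (MvPolynomial (Fin N) K) :=
  Ideal.span (leadTerm mo '' (I : Set (MvPolynomial (Fin N) K)))

/-- The Gröbner cone `C_≺(I)`. -/
noncomputable def gCone (mo : MonoOrder N) (I : Ideal (MvPolynomial (Fin N) K)) :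
    Set (Fin N → ℝ) :=
  closure {ω | (∀ i, 0 ≤ ω i) ∧ ltIdealW ω I = ltIdealO mo I}

/-- `G` is the normed reduced Gröbner basis of `I` w.r.t. `mo`. -/
def IsRedGB (mo : MonoOrder N) (I : Ideal (MvPolynomial (Fin N) K))
    (G : Set (MvPolynomial (Fin N) K)) : Prop :=
  G.Finite ∧ G ⊆ (I : Set (MvPolynomial (Fin N) K)) ∧
  Ideal.span (leadTerm mo '' G) = ltIdealO mo I ∧
  (∀ g ∈ G, g ≠ 0 ∧ g.coeff (leadExp mo g) = 1) ∧
  (∀ g ∈ G, ∀ h ∈ G, g ≠ h → ∀ d ∈ h.support, ¬ leadExp mo g ≤ d)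

/-- `mo` is an `I`-specific elimination order for the last variables:
every element of the reduced Gröbner basis whose leading term lies in `K[X]`
lies itself in `K[X]`. -/
def IsEO (n : ℕ) (mo : MonoOrder N) (I : Ideal (MvPolynomial (Fin N) K)) : Prop :=
  ∀ G : Set (MvPolynomial (Fin N) K), IsRedGB mo I G →
    ∀ g ∈ G, inKX n (leadTerm mo g) → inKX n g

/-- `ω` is an `I`-specific elimination vector. -/
def IsEV (n : ℕ) (I : Ideal (MvPolynomial (Fin N) K)) (ω : Fin N → ℝ) : Prop :=
  (∀ i, 0 ≤ ω i) ∧ ∃ mo : MonoOrder N, IsEO n mo I ∧ ω ∈ gCone mo I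

/-- The monomial order `mo` refines the weight vector `ω`. -/
def Refines (mo : MonoOrder N) (ω : Fin N → ℝ) : Prop :=
  ∀ d e : Fin N →₀ ℕ, wdeg ω ⇑d < wdeg ω ⇑e → mo.lt d e

/-- `Ω_u`: the set of weight vectors vanishing on the first `n` coordinates. -/
def OmegaU (n N : ℕ) : Set (Fin N → ℝ) :=
  {ω | (∀ i, 0 ≤ ω i) ∧ ∀ i : Fin N, (i : ℕ) < n → ω i = 0}

/-- `L_{X,≺}(G)`: the elements of `G` whose leading term lies in `K[X]`. -/
def LXset (n : ℕ) (mo : MonoOrder N) (G : Set (MvPolynomial (Fin N) K)) :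
    Set (MvPolynomial (Fin N) K) :=
  {p ∈ G | inKX n (leadTerm mo p)}
lemma castAdd_inj (n m : ℕ) : Function.Injective (Fin.castAdd m : Fin n → Fin (n + m)) := by
  intro a b h
  exact Fin.ext (by simpa using congrArg Fin.val h)

/-- Extend an exponent vector on the first `n` variables to all `n + m` variables. -/
noncomputable def extExp (n m : ℕ) (a : Fin n →₀ ℕ) : Fin (n + m) →₀ ℕ :=
  Finsupp.mapDomain (Fin.castAdd m) a

/-- The restriction of a monomial order on `K[X][U]` to the monomials of `K[X]`. -/
noncomputable def restrictOrder (n m : ℕ) (mo : MonoOrder (n + m)) : MonoOrder n where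
  lt a b := mo.lt (extExp n m a) (extExp n m b)
  total a b := by
    rcases mo.total (extExp n m a) (extExp n m b) with h | h | h
    · exact Or.inl (Finsupp.mapDomain_injective (castAdd_inj n m) h)
    · exact Or.inr (Or.inl h)
    · exact Or.inr (Or.inr h)
  trans a b c hab hbc := mo.trans _ _ _ hab hbc
  irrefl a := mo.irrefl _
  add_right a b c h := by
    show mo.lt (extExp n m (a + c)) (extExp n m (b + c))
    rw [show extExp n m (a + c) = extExp n m a + extExp n m c from Finsupp.mapDomain_add,
        show extExp n m (b + c) = extExp n m b + extExp n m c from Finsupp.mapDomain_add]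
    exact mo.add_right _ _ _ h
  zero_lt a ha := by
    show mo.lt (extExp n m 0) (extExp n m a)
    have h0 : extExp n m (0 : Fin n →₀ ℕ) = 0 := Finsupp.mapDomain_zero
    rw [h0]
    refine mo.zero_lt _ (fun h => ha ?_)
    exact Finsupp.mapDomain_injective (castAdd_inj n m) (h.trans h0.symm)

/-- The projection `K[X][U] → K[X]` sending each `u`-variable to `0`;
on polynomials of `K[X]` it inverts the canonical inclusion `K[X] → K[X][U]`. -/
noncomputable def projX (n m : ℕ) (K : Type*) [Field K] :
    MvPolynomial (Fin (n + m)) K →ₐ[K] MvPolynomial (Fin n) K :=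
  aeval (fun i : Fin (n + m) => if h : (i : ℕ) < n then X ⟨(i : ℕ), h⟩ else 0)

/-- The elimination ideal `I ∩ K[X]`, viewed as an ideal of `K[x_1,…,x_n]` via the
canonical inclusion `K[X] → K[X][U]`. -/
noncomputable def elimIdeal (n m : ℕ) {K : Type*} [Field K]
    (I : Ideal (MvPolynomial (Fin (n + m)) K)) : Ideal (MvPolynomial (Fin n) K) :=
  Ideal.comap
    (rename (Fin.castAdd m) : MvPolynomial (Fin n) K →ₐ[K] MvPolynomial (Fin (n + m)) K) I

/-- Priority of the variables for the lex order `u_1 ≻ … ≻ u_m ≻ x_1 ≻ … ≻ x_n`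
(smaller priority value = more significant variable). -/
def uPrio (n m : ℕ) (i : Fin (n + m)) : ℕ :=
  if (i : ℕ) < n then m + (i : ℕ) else (i : ℕ) - n

/-- The pure lexicographic order with `u_1 ≻ … ≻ u_m ≻ x_1 ≻ … ≻ x_n`:
`a <_lex b` iff at the most significant position where they differ, `a` is smaller. -/
def uLexLt (n m : ℕ) (a b : Fin (n + m) →₀ ℕ) : Prop :=
  ∃ i : Fin (n + m), a i < b i ∧ ∀ j : Fin (n + m), uPrio n m j < uPrio n m i → a j = b j

namespace MonoOrder

lemma asymm (mo : MonoOrder N) {a b : Fin N →₀ ℕ} (h : mo.lt a b) : ¬ mo.lt b a :=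
  fun h' => mo.irrefl _ (mo.trans _ _ _ h h')

lemma lt_of_le_of_ne (mo : MonoOrder N) {a b : Fin N →₀ ℕ} (h : a ≤ b) (hne : a ≠ b) :
    mo.lt a b := by
  obtain ⟨c, rfl⟩ := exists_add_of_le h
  have hc : c ≠ 0 := by
    rintro rfl
    simp at hne
  have := mo.add_right 0 c a (mo.zero_lt c hc)
  rwa [zero_add, add_comm] at this

lemma not_lt_of_le (mo : MonoOrder N) {a b : Fin N →₀ ℕ} (h : a ≤ b) : ¬ mo.lt b a := by
  by_cases hne : a = b
  · rw [hne]
    exact mo.irrefl b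
  · exact mo.asymm (mo.lt_of_le_of_ne h hne)

lemma wellFounded (mo : MonoOrder N) : WellFounded mo.lt := by
  have : IsStrictOrder _ mo.lt := { irrefl := mo.irrefl, trans := mo.trans }
  rw [RelEmbedding.wellFounded_iff_isEmpty]
  refine ⟨fun f => ?_⟩
  obtain ⟨i, j, hij, hle⟩ := wellQuasiOrdered_le (fun i => f i)
  exact mo.not_lt_of_le hle (f.map_rel_iff.2 hij)

/-- Every nonempty finite set of exponents has a greatest element for the monomial order. -/
lemma exists_greatest (mo : MonoOrder N) (s : Finset (Fin N →₀ ℕ)) (hs : s.Nonempty) :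
    ∃ d ∈ s, ∀ e ∈ s, e ≠ d → mo.lt e d := by
  induction hs using Finset.Nonempty.cons_induction with
  | singleton a => exact ⟨a, by simp, fun e he hne => absurd (Finset.mem_singleton.1 he) hne⟩
  | cons a s ha hs ih =>
    obtain ⟨d, hd, hmax⟩ := ih
    rcases mo.total a d with h | h | h
    · exact absurd (h ▸ hd) ha
    · refine ⟨d, Finset.mem_cons_of_mem hd, fun e he hne => ?_⟩
      rcases Finset.mem_cons.1 he with rfl | he
      · exact h
      · exact hmax e he hne
    · refine ⟨a, Finset.mem_cons_self a s, fun e he hne => ?_⟩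
      rcases Finset.mem_cons.1 he with rfl | he
      · exact absurd rfl hne
      · by_cases hed : e = d
        · rwa [hed]
        · exact mo.trans _ _ _ (hmax e he hed) h

end MonoOrder

lemma leadExp_spec (mo : MonoOrder N) {p : MvPolynomial (Fin N) K} (hp : p ≠ 0) :
    leadExp mo p ∈ p.support ∧ ∀ e ∈ p.support, e ≠ leadExp mo p → mo.lt e (leadExp mo p) := by
  have h := mo.exists_greatest p.support (support_nonempty.2 hp)
  rw [leadExp, dif_pos h]
  exact h.choose_spec

lemma leadExp_eq (mo : MonoOrder N) {p : MvPolynomial (Fin N) K} {d : Fin N →₀ ℕ}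
    (hd : d ∈ p.support) (h : ∀ e ∈ p.support, e ≠ d → mo.lt e d) : leadExp mo p = d := by
  have hp : p ≠ 0 := by
    rintro rfl
    simp at hd
  obtain ⟨h₁, h₂⟩ := leadExp_spec mo hp
  by_contra hne
  exact mo.asymm (h _ h₁ hne) (h₂ d hd (Ne.symm hne))

lemma not_le_leadExp (mo : MonoOrder N) {p : MvPolynomial (Fin N) K} {e : Fin N →₀ ℕ}
    (he : e ∈ p.support) (hne : e ≠ leadExp mo p) : ¬ leadExp mo p ≤ e := by
  have hp : p ≠ 0 := by
    rintro rfl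
    simp at he
  exact fun hle => mo.not_lt_of_le hle ((leadExp_spec mo hp).2 e he hne)

lemma support_leadTerm (mo : MonoOrder N) {p : MvPolynomial (Fin N) K} (hp : p ≠ 0) :
    (leadTerm mo p).support = {leadExp mo p} := by
  classical
  rw [leadTerm, support_monomial, if_neg (mem_support_iff.1 (leadExp_spec mo hp).1)]

lemma inKX_leadTerm_iff (n : ℕ) (mo : MonoOrder N) {p : MvPolynomial (Fin N) K} (hp : p ≠ 0) :
    inKX n (leadTerm mo p) ↔ ∀ i : Fin N, n ≤ (i : ℕ) → leadExp mo p i = 0 := by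
  simp [inKX, support_leadTerm mo hp]

lemma leadTerm_zero (mo : MonoOrder N) : leadTerm mo (0 : MvPolynomial (Fin N) K) = 0 := by
  simp [leadTerm]

/-- Every exponent of a polynomial in an ideal generated by leading terms is divisible by one
of the leading exponents. -/
lemma exists_leadExp_le_of_mem_span (mo : MonoOrder N) {A : Set (MvPolynomial (Fin N) K)}
    {p : MvPolynomial (Fin N) K} (hp : p ∈ Ideal.span (leadTerm mo '' A))
    {d : Fin N →₀ ℕ} (hd : d ∈ p.support) : ∃ f ∈ A, f ≠ 0 ∧ leadExp mo f ≤ d := by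
  have hle : Ideal.span (leadTerm mo '' A) ≤ Ideal.span
      ((fun s => monomial s (1 : K)) '' (leadExp mo '' {f ∈ A | f ≠ 0})) := by
    rw [Ideal.span_le]
    rintro _ ⟨f, hf, rfl⟩
    by_cases h0 : f = 0
    · rw [h0, leadTerm_zero]
      exact zero_mem _
    · rw [SetLike.mem_coe, mem_ideal_span_monomial_image]
      intro e he
      rw [support_leadTerm mo h0, Finset.mem_singleton] at he
      exact ⟨_, ⟨f, ⟨hf, h0⟩, rfl⟩, he.ge⟩
  obtain ⟨_, ⟨f, ⟨hf, h0⟩, rfl⟩, hfd⟩ := mem_ideal_span_monomial_image.1 (hle hp) d hd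
  exact ⟨f, hf, h0, hfd⟩

lemma mem_support_initForm {ω : Fin N → ℝ} {p : MvPolynomial (Fin N) K} {d : Fin N →₀ ℕ} :
    d ∈ (initForm ω p).support ↔ d ∈ p.support ∧ ∀ e ∈ p.support, wdeg ω ⇑e ≤ wdeg ω ⇑d := by
  classical
  rw [mem_support_iff, initForm, coeff_sum]
  simp only [coeff_monomial]
  rw [Finset.sum_ite_eq']
  split_ifs with h
  · have h' := Finset.mem_filter.1 h
    exact iff_of_true (mem_support_iff.1 h'.1) h'
  · exact iff_of_false (fun h0 => h0 rfl) (fun h' => h (Finset.mem_filter.2 h'))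

namespace IsRedGB

variable {mo : MonoOrder N} {I : Ideal (MvPolynomial (Fin N) K)}
  {G : Set (MvPolynomial (Fin N) K)}

lemma mem_ideal (hG : IsRedGB mo I G) {g : MvPolynomial (Fin N) K} (hg : g ∈ G) : g ∈ I :=
  hG.2.1 hg

lemma ne_zero (hG : IsRedGB mo I G) {g : MvPolynomial (Fin N) K} (hg : g ∈ G) : g ≠ 0 :=
  (hG.2.2.2.1 g hg).1

lemma coeff_leadExp (hG : IsRedGB mo I G) {g : MvPolynomial (Fin N) K} (hg : g ∈ G) :
    g.coeff (leadExp mo g) = 1 :=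
  (hG.2.2.2.1 g hg).2

lemma exists_leadExp_le (hG : IsRedGB mo I G) {p : MvPolynomial (Fin N) K}
    (hp : p ∈ ltIdealO mo I) {d : Fin N →₀ ℕ} (hd : d ∈ p.support) :
    ∃ g ∈ G, leadExp mo g ≤ d := by
  rw [← hG.2.2.1] at hp
  obtain ⟨g, hg, -, h⟩ := exists_leadExp_le_of_mem_span mo hp hd
  exact ⟨g, hg, h⟩

lemma not_leadExp_le (hG : IsRedGB mo I G) {g h : MvPolynomial (Fin N) K} (hg : g ∈ G)
    (hh : h ∈ G) {e : Fin N →₀ ℕ} (he : e ∈ g.support) (hne : e ≠ leadExp mo g) :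
    ¬ leadExp mo h ≤ e := by
  by_cases hhg : h = g
  · rw [hhg]
    exact not_le_leadExp mo he hne
  · exact hG.2.2.2.2 h hh g hg hhg e he

lemma eq_of_leadExp_le (hG : IsRedGB mo I G) {g h : MvPolynomial (Fin N) K} (hg : g ∈ G)
    (hh : h ∈ G) (hle : leadExp mo h ≤ leadExp mo g) : h = g := by
  by_contra hne
  exact hG.2.2.2.2 h hh g hg hne _ (leadExp_spec mo (hG.ne_zero hg)).1 hle

/-- An element of the ideal all of whose exponents are standard vanishes. -/
lemma eq_zero_of_standard (hG : IsRedGB mo I G) {p : MvPolynomial (Fin N) K} (hp : p ∈ I)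
    (h : ∀ d ∈ p.support, ∀ g ∈ G, ¬ leadExp mo g ≤ d) : p = 0 := by
  by_contra h0
  have hmem : leadTerm mo p ∈ ltIdealO mo I := Ideal.subset_span ⟨p, hp, rfl⟩
  obtain ⟨g, hg, hle⟩ := hG.exists_leadExp_le hmem
    (d := leadExp mo p) (by simp [support_leadTerm mo h0])
  exact h _ (leadExp_spec mo h0).1 g hg hle

lemma wdeg_lt_of_ltIdealW_eq (hG : IsRedGB mo I G) {ω : Fin N → ℝ}
    (hω : ltIdealW ω I = ltIdealO mo I) {g : MvPolynomial (Fin N) K} (hg : g ∈ G)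
    {e : Fin N →₀ ℕ} (he : e ∈ g.support) (hne : e ≠ leadExp mo g) :
    wdeg ω ⇑e < wdeg ω ⇑(leadExp mo g) := by
  have hmem : initForm ω g ∈ ltIdealO mo I :=
    hω ▸ Ideal.subset_span ⟨g, hG.mem_ideal hg, rfl⟩
  have key : ∀ d ∈ g.support, (∀ e ∈ g.support, wdeg ω ⇑e ≤ wdeg ω ⇑d) →
      d = leadExp mo g := by
    intro d hd hmax
    by_contra hdne
    obtain ⟨h, hh, hle⟩ := hG.exists_leadExp_le hmem (mem_support_initForm.2 ⟨hd, hmax⟩)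
    exact hG.not_leadExp_le hg hh hd hdne hle
  obtain ⟨d, hd, hmax⟩ := g.support.exists_max_image (fun d => wdeg ω ⇑d) ⟨e, he⟩
  have hd' := key d hd hmax
  subst hd'
  refine lt_of_not_ge fun hge => hne (key e he fun e' he' => (hmax e' he').trans hge)

end IsRedGB

lemma continuous_wdeg (d : Fin N → ℕ) : Continuous fun ω : Fin N → ℝ => wdeg ω d := by
  unfold wdeg
  fun_prop

/-- In the interior of the Gröbner cone, the leading exponent of an element of the reduced
Gröbner basis is the unique exponent of maximal weight. -/
lemma IsRedGB.wdeg_lt_of_mem_interior {mo : MonoOrder N} {I : Ideal (MvPolynomial (Fin N) K)}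
    {G : Set (MvPolynomial (Fin N) K)} (hG : IsRedGB mo I G) {ω : Fin N → ℝ}
    (hω : ω ∈ interior (gCone mo I)) {g : MvPolynomial (Fin N) K} (hg : g ∈ G)
    {e : Fin N →₀ ℕ} (he : e ∈ g.support) (hne : e ≠ leadExp mo g) :
    wdeg ω ⇑e < wdeg ω ⇑(leadExp mo g) := by
  have hle : ∀ ω' ∈ gCone mo I, wdeg ω' ⇑e ≤ wdeg ω' ⇑(leadExp mo g) := by
    have hclosed : IsClosed {ω' : Fin N → ℝ | wdeg ω' ⇑e ≤ wdeg ω' ⇑(leadExp mo g)} :=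
      isClosed_le (continuous_wdeg _) (continuous_wdeg _)
    exact closure_minimal (fun ω' h => (hG.wdeg_lt_of_ltIdealW_eq h.2 hg he hne).le) hclosed
  let v : Fin N → ℝ := fun i => (e i : ℝ) - (leadExp mo g i : ℝ)
  have hlim : Filter.Tendsto (fun t : ℝ => ω + t • v) (nhdsWithin 0 (Set.Ioi 0)) (nhds ω) := by
    have : Continuous fun t : ℝ => ω + t • v := by fun_prop
    simpa using (this.tendsto 0).mono_left nhdsWithin_le_nhds
  obtain ⟨t, htmem, ht⟩ :=
    ((hlim.eventually (mem_interior_iff_mem_nhds.1 hω)).and self_mem_nhdsWithin).exists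
  have ht : 0 < t := ht
  have hdiff : ∀ ω' : Fin N → ℝ, wdeg ω' ⇑e - wdeg ω' ⇑(leadExp mo g) = ∑ i, ω' i * v i := by
    intro ω'
    simp only [wdeg, v, mul_sub, Finset.sum_sub_distrib]
  have hv : 0 < ∑ i, v i * v i := by
    obtain ⟨i, hi⟩ := DFunLike.ne_iff.1 hne
    refine Finset.sum_pos' (fun i _ => mul_self_nonneg _) ⟨i, Finset.mem_univ i, ?_⟩
    exact mul_self_pos.2 (sub_ne_zero.2 (by exact_mod_cast hi))
  have h₁ := hle _ htmem
  have h₂ := hdiff (ω + t • v)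
  have h₃ := hdiff ω
  have h₄ : ∑ i, (ω + t • v) i * v i = ∑ i, ω i * v i + t * ∑ i, v i * v i := by
    rw [Finset.mul_sum, ← Finset.sum_add_distrib]
    refine Finset.sum_congr rfl fun i _ => ?_
    simp only [Pi.add_apply, Pi.smul_apply, smul_eq_mul]
    ring
  nlinarith [mul_pos ht hv]

/-- If `d` is the unique exponent of maximal weight of some `f ∈ I`, for a weight in the
Gröbner cone, then `d` is divisible by a leading exponent of the reduced Gröbner basis. -/
lemma IsRedGB.exists_leadExp_le_of_wdeg_lt {mo : MonoOrder N}
    {I : Ideal (MvPolynomial (Fin N) K)} {G : Set (MvPolynomial (Fin N) K)}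
    (hG : IsRedGB mo I G) {ω : Fin N → ℝ} (hω : ω ∈ gCone mo I)
    {f : MvPolynomial (Fin N) K} (hf : f ∈ I) {d : Fin N →₀ ℕ} (hd : d ∈ f.support)
    (h : ∀ e ∈ f.support, e ≠ d → wdeg ω ⇑e < wdeg ω ⇑d) : ∃ g ∈ G, leadExp mo g ≤ d := by
  have hopen : ∀ᶠ ω' in nhds ω, ∀ e ∈ f.support, e ≠ d → wdeg ω' ⇑e < wdeg ω' ⇑d := by
    rw [Filter.eventually_all_finset]
    intro e he
    by_cases hed : e = d
    · exact Filter.Eventually.of_forall fun _ hne => absurd hed hne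
    · filter_upwards [(isOpen_lt (continuous_wdeg _) (continuous_wdeg _)).mem_nhds
        (h e he hed)] with _ h' _ using h'
  obtain ⟨ω', hlt, -, hω'⟩ := mem_closure_iff_nhds.1 hω _ hopen
  have hmem : initForm ω' f ∈ ltIdealO mo I := hω' ▸ Ideal.subset_span ⟨f, hf, rfl⟩
  refine hG.exists_leadExp_le hmem (mem_support_initForm.2 ⟨hd, fun e he => ?_⟩)
  by_cases hed : e = d
  · rw [hed]
  · exact (hlt e he hed).le

/-- The exponents of the leading terms of the nonzero elements of an ideal. -/
def leadExps (mo : MonoOrder N) (I : Ideal (MvPolynomial (Fin N) K)) : Set (Fin N →₀ ℕ) :=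
  {d | ∃ f ∈ I, f ≠ 0 ∧ leadExp mo f = d}

lemma isUpperSet_leadExps (mo : MonoOrder N) (I : Ideal (MvPolynomial (Fin N) K)) :
    IsUpperSet (leadExps mo I) := by
  rintro _ b hle ⟨f, hf, h0, rfl⟩
  obtain ⟨c, rfl⟩ := exists_add_of_le hle
  obtain ⟨h₁, h₂⟩ := leadExp_spec mo h0
  have hc : leadExp mo f + c ∈ (f * monomial c 1).support := by
    rw [mem_support_iff, coeff_mul_monomial, mul_one]
    exact mem_support_iff.1 h₁
  refine ⟨f * monomial c 1, I.mul_mem_right _ hf, support_nonempty.1 ⟨_, hc⟩,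
    leadExp_eq mo hc fun e he hne => ?_⟩
  rw [mem_support_iff, coeff_mul_monomial'] at he
  split_ifs at he with hce
  · obtain ⟨e', rfl⟩ := exists_add_of_le hce
    rw [add_tsub_cancel_left, mul_one] at he
    rw [add_comm c e'] at hne ⊢
    exact mo.add_right _ _ _ (h₂ e' (mem_support_iff.2 he) fun h => hne (by rw [h]))
  · exact absurd rfl he

/-- Existence of normal forms of monomials modulo an ideal. -/
lemma exists_normalForm_monomial (mo : MonoOrder N) (I : Ideal (MvPolynomial (Fin N) K))
    (d : Fin N →₀ ℕ) : ∃ r : MvPolynomial (Fin N) K, monomial d 1 - r ∈ I ∧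
      ∀ e ∈ r.support, e ∉ leadExps mo I ∧ (e = d ∨ mo.lt e d) := by
  classical
  induction d using mo.wellFounded.induction with
  | _ d ih =>
  by_cases hd : d ∈ leadExps mo I
  · obtain ⟨f, hf, h0, rfl⟩ := hd
    obtain ⟨h₁, h₂⟩ := leadExp_spec mo h0
    choose! r hr hr' using ih
    set a := f.coeff (leadExp mo f) with ha
    have ha0 : a ≠ 0 := mem_support_iff.1 h₁
    set s := f.support.erase (leadExp mo f) with hs
    have hlt : ∀ e ∈ s, mo.lt e (leadExp mo f) := fun e he =>
      h₂ e (Finset.mem_of_mem_erase he) (Finset.ne_of_mem_erase he)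
    refine ⟨∑ e ∈ s, C (-(a⁻¹ * f.coeff e)) * r e, ?_, fun e he => ?_⟩
    · have hfsum : f = monomial (leadExp mo f) a + ∑ e ∈ s, monomial e (f.coeff e) := by
        conv_lhs => rw [f.as_sum]
        rw [hs, Finset.add_sum_erase _ (fun e => monomial e (f.coeff e)) h₁]
      have hCf : C a⁻¹ * f =
          monomial (leadExp mo f) 1 + ∑ e ∈ s, monomial e (a⁻¹ * f.coeff e) := by
        have h := congrArg (C a⁻¹ * ·) hfsum
        simpa only [mul_add, Finset.mul_sum, C_mul_monomial, inv_mul_cancel₀ ha0] using h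
      have hexp : monomial (leadExp mo f) 1 - ∑ e ∈ s, C (-(a⁻¹ * f.coeff e)) * r e =
          C a⁻¹ * f - ∑ e ∈ s, C (a⁻¹ * f.coeff e) * (monomial e 1 - r e) := by
        rw [hCf]
        simp only [mul_sub, Finset.sum_sub_distrib, C_mul_monomial, mul_one, map_neg, neg_mul,
          Finset.sum_neg_distrib]
        ring
      rw [hexp]
      exact sub_mem (I.mul_mem_left _ hf)
        (sum_mem fun e he => I.mul_mem_left _ (hr e (hlt e he)))
    · obtain ⟨e', he', hmem⟩ := Finset.mem_biUnion.1 (support_sum he)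
      have hmem' : e ∈ (r e').support := by
        rw [mem_support_iff, coeff_C_mul] at hmem
        exact mem_support_iff.2 (right_ne_zero_of_mul hmem)
      obtain ⟨h₃, h₄⟩ := hr' e' (hlt e' he') e hmem'
      refine ⟨h₃, Or.inr ?_⟩
      rcases h₄ with rfl | h₄
      · exact hlt _ he'
      · exact mo.trans _ _ _ h₄ (hlt _ he')
  · refine ⟨monomial d 1, by simp, fun e he => ?_⟩
    obtain rfl := Finset.mem_singleton.1 (support_monomial_subset he)
    exact ⟨hd, Or.inl rfl⟩

/-- Every ideal has a reduced Gröbner basis for every monomial order. -/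
lemma exists_isRedGB (mo : MonoOrder N) (I : Ideal (MvPolynomial (Fin N) K)) :
    ∃ G, IsRedGB mo I G := by
  classical
  choose r hr hr' using exists_normalForm_monomial mo I
  set M : Set (Fin N →₀ ℕ) := {d | Minimal (· ∈ leadExps mo I) d} with hM
  set g : (Fin N →₀ ℕ) → MvPolynomial (Fin N) K := fun d => monomial d 1 - r d with hg
  have hsupp : ∀ d ∈ M, ∀ e ∈ (g d).support, e ≠ d → e ∈ (r d).support := by
    intro d _ e he hne
    rw [mem_support_iff, hg, coeff_sub, coeff_monomial, if_neg (Ne.symm hne), zero_sub,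
      neg_ne_zero] at he
    exact mem_support_iff.2 he
  have hcoeff : ∀ d ∈ M, (g d).coeff d = 1 := by
    intro d hd
    have : (r d).coeff d = 0 := notMem_support_iff.1 fun h => (hr' d d h).1 hd.prop
    simp [hg, this]
  have hmem : ∀ d ∈ M, d ∈ (g d).support := fun d hd =>
    mem_support_iff.2 (by simp [hcoeff d hd])
  have hlead : ∀ d ∈ M, leadExp mo (g d) = d := fun d hd =>
    leadExp_eq mo (hmem d hd) fun e he hne =>
      (hr' d e (hsupp d hd e he hne)).2.resolve_left hne
  have hterm : ∀ d ∈ M, leadTerm mo (g d) = monomial d 1 := fun d hd => by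
    rw [leadTerm, hlead d hd, hcoeff d hd]
  refine ⟨g '' M, ?_, ?_, ?_, ?_, ?_⟩
  · exact ((setOfPred_minimal_antichain _).finite_of_wellQuasiOrdered wellQuasiOrdered_le).image g
  · rintro _ ⟨d, -, rfl⟩
    exact hr d
  · refine le_antisymm (Ideal.span_mono (Set.image_mono ?_)) (Ideal.span_le.2 ?_)
    · rintro _ ⟨d, -, rfl⟩
      exact hr d
    · rintro _ ⟨f, hf, rfl⟩
      by_cases h0 : f = 0
      · rw [h0, leadTerm_zero]
        exact zero_mem _
      · obtain ⟨d, hle, hd⟩ := (Set.isPWO_of_wellQuasiOrderedLE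
          (leadExps mo I)).exists_le_minimal ⟨f, hf, h0, rfl⟩
        obtain ⟨c, hc⟩ := exists_add_of_le hle
        have : leadTerm mo f = monomial c (f.coeff (leadExp mo f)) * leadTerm mo (g d) := by
          rw [hterm d hd, monomial_mul, mul_one, add_comm c d, ← hc, leadTerm]
        rw [this]
        exact Ideal.mul_mem_left _ _ (Ideal.subset_span ⟨_, ⟨d, hd, rfl⟩, rfl⟩)
  · rintro _ ⟨d, hd, rfl⟩
    exact ⟨support_nonempty.1 ⟨d, hmem d hd⟩, by rw [hlead d hd, hcoeff d hd]⟩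
  · rintro _ ⟨d, hd, rfl⟩ _ ⟨d', hd', rfl⟩ hne e he hle
    rw [hlead d hd] at hle
    by_cases hed : e = d'
    · subst hed
      exact hne (congrArg g (le_antisymm hle (hd'.le_of_le hd.prop hle)))
    · exact (hr' d' e (hsupp d' hd' e he hed)).1 (isUpperSet_leadExps mo I hle hd.prop)

lemma wdeg_combination (a b : ℝ) (σ τ : Fin N → ℝ) (d : Fin N → ℕ) :
    wdeg (a • σ + b • τ) d = a * wdeg σ d + b * wdeg τ d := by
  simp only [wdeg, Pi.add_apply, Pi.smul_apply, smul_eq_mul, Finset.mul_sum,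
    ← Finset.sum_add_distrib]
  exact Finset.sum_congr rfl fun i _ => by ring

lemma wdeg_nonneg {τ : Fin N → ℝ} (hτ : ∀ i, 0 ≤ τ i) (d : Fin N → ℕ) : 0 ≤ wdeg τ d :=
  Finset.sum_nonneg fun i _ => mul_nonneg (hτ i) (Nat.cast_nonneg _)

lemma wdeg_eq_zero_of_mem_OmegaU {n : ℕ} {τ : Fin N → ℝ} (hτ : τ ∈ OmegaU n N)
    {d : Fin N → ℕ} (hd : ∀ i : Fin N, n ≤ (i : ℕ) → d i = 0) : wdeg τ d = 0 := by
  refine Finset.sum_eq_zero fun i _ => ?_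
  rcases lt_or_ge (i : ℕ) n with h | h
  · rw [hτ.2 i h, zero_mul]
  · rw [hd i h, Nat.cast_zero, mul_zero]

/-- Moving a weight towards `Ω_u` does not change the part of the reduced Gröbner basis whose
leading terms lie in `K[X]`, provided this part is contained in `K[X]`. -/
lemma LXset_eq_of_segment_interior {n : ℕ} {I : Ideal (MvPolynomial (Fin N) K)}
    {σ τ ω : Fin N → ℝ} (hτ : τ ∈ OmegaU n N) (hω : ω ∈ segment ℝ σ τ) (hωτ : ω ≠ τ)
    {mos mow : MonoOrder N} (hσ : σ ∈ interior (gCone mos I))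
    (hint : ω ∈ interior (gCone mow I)) {Gσ Gω : Set (MvPolynomial (Fin N) K)}
    (hGσ : IsRedGB mos I Gσ) (hGω : IsRedGB mow I Gω)
    (hEO : ∀ p ∈ LXset n mos Gσ, inKX n p) : LXset n mow Gω = LXset n mos Gσ := by
  obtain ⟨a, b, ha, hb, hab, rfl⟩ := hω
  have ha' : 0 < a := by
    refine ha.lt_of_ne fun h => hωτ ?_
    subst h
    rw [zero_add] at hab
    simp [hab]
  have hdown : ∀ {c d : Fin N →₀ ℕ}, c ≤ d → (∀ i : Fin N, n ≤ (i : ℕ) → d i = 0) →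
      ∀ i : Fin N, n ≤ (i : ℕ) → c i = 0 :=
    fun hcd h i hi => Nat.le_zero.1 ((hcd i).trans_eq (h i hi))
  have hσω : ∀ d : Fin N →₀ ℕ, (∀ i : Fin N, n ≤ (i : ℕ) → d i = 0) →
      ∀ h ∈ Gσ, leadExp mos h ≤ d → ∃ g ∈ Gω, leadExp mow g ≤ d := by
    intro d hdX h hh hle
    have hlX := hdown hle hdX
    have hhX : inKX n h := hEO h ⟨hh, (inKX_leadTerm_iff n mos (hGσ.ne_zero hh)).2 hlX⟩
    obtain ⟨g, hg, hgl⟩ := hGω.exists_leadExp_le_of_wdeg_lt (interior_subset hint)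
      (hGσ.mem_ideal hh) (leadExp_spec mos (hGσ.ne_zero hh)).1 (fun e he hne => by
        rw [wdeg_combination, wdeg_combination, wdeg_eq_zero_of_mem_OmegaU hτ hlX,
          wdeg_eq_zero_of_mem_OmegaU hτ (hhX e he)]
        simpa using mul_lt_mul_of_pos_left
          (hGσ.wdeg_lt_of_mem_interior hσ hh he hne) ha')
    exact ⟨g, hg, hgl.trans hle⟩
  have hωσ : ∀ g ∈ Gω, (∀ i : Fin N, n ≤ (i : ℕ) → leadExp mow g i = 0) →
      ∃ h ∈ Gσ, leadExp mos h ≤ leadExp mow g := by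
    intro g hg hlX
    refine hGσ.exists_leadExp_le_of_wdeg_lt (interior_subset hσ) (hGω.mem_ideal hg)
      (leadExp_spec mow (hGω.ne_zero hg)).1 (fun e he hne => ?_)
    have h := hGω.wdeg_lt_of_mem_interior hint hg he hne
    rw [wdeg_combination, wdeg_combination, wdeg_eq_zero_of_mem_OmegaU hτ hlX] at h
    have h' := mul_nonneg hb (wdeg_nonneg hτ.1 ⇑e)
    exact lt_of_mul_lt_mul_left (by linarith) ha
  have key : ∀ g ∈ Gω, (∀ i : Fin N, n ≤ (i : ℕ) → leadExp mow g i = 0) →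
      g ∈ Gσ ∧ leadExp mos g = leadExp mow g := by
    intro g hg hlX
    obtain ⟨h, hh, hle⟩ := hωσ g hg hlX
    have hhlX := hdown hle hlX
    have hhX : inKX n h := hEO h ⟨hh, (inKX_leadTerm_iff n mos (hGσ.ne_zero hh)).2 hhlX⟩
    have hlead : leadExp mos h = leadExp mow g := by
      obtain ⟨g', hg', hle'⟩ := hσω _ hhlX h hh le_rfl
      rw [hGω.eq_of_leadExp_le hg hg' (hle'.trans hle)] at hle'
      exact le_antisymm hle hle'
    have hgh : g = h := by
      refine sub_eq_zero.1 (hGω.eq_zero_of_standard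
        (sub_mem (hGω.mem_ideal hg) (hGσ.mem_ideal hh)) fun e he g' hg' hle' => ?_)
      have hne : e ≠ leadExp mow g := by
        rintro rfl
        rw [mem_support_iff, coeff_sub, hGω.coeff_leadExp hg, ← hlead,
          hGσ.coeff_leadExp hh, sub_self] at he
        exact he rfl
      by_cases heg : e ∈ g.support
      · exact hGω.not_leadExp_le hg hg' heg hne hle'
      · have heh : e ∈ h.support := by
          rw [mem_support_iff, coeff_sub, notMem_support_iff.1 heg, zero_sub, neg_ne_zero] at he
          exact mem_support_iff.2 he
        obtain ⟨h', hh', hle''⟩ := hωσ g' hg' (hdown hle' (hhX e heh))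
        exact hGσ.not_leadExp_le hh hh' heh (hlead ▸ hne) (hle''.trans hle')
    subst hgh
    exact ⟨hh, hlead⟩
  ext p
  constructor
  · rintro ⟨hp, hpX⟩
    rw [inKX_leadTerm_iff n mow (hGω.ne_zero hp)] at hpX
    obtain ⟨h₁, h₂⟩ := key p hp hpX
    exact ⟨h₁, (inKX_leadTerm_iff n mos (hGσ.ne_zero h₁)).2 (h₂ ▸ hpX)⟩
  · rintro ⟨hp, hpX⟩
    rw [inKX_leadTerm_iff n mos (hGσ.ne_zero hp)] at hpX
    obtain ⟨g, hg, hle⟩ := hσω _ hpX p hp le_rfl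
    have hgX := hdown hle hpX
    obtain ⟨h₁, h₂⟩ := key g hg hgX
    obtain rfl := hGσ.eq_of_leadExp_le hp h₁ (h₂.trans_le hle)
    exact ⟨hg, (inKX_leadTerm_iff n mow (hGω.ne_zero hg)).2 hgX⟩

/-- Let `≺_σ` be an `I`-EO with `σ ∈ int C_{≺_σ}(I)`, `τ ∈ Ω_u`,
`ω ∈ [σ,τ] \ {τ}`, and `≺_ω` with `ω ∈ int C_{≺_ω}(I)`. Then
`L_{X,≺_ω}(GB(I,≺_ω)) = L_{X,≺_σ}(GB(I,≺_σ)) ⊆ K[X]`, and `≺_ω` is itself an `I`-EO. -/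
theorem EO_of_segment_interior (n m : ℕ) {K : Type*} [Field K]
    (I : Ideal (MvPolynomial (Fin (n + m)) K))
    (σ τ ω : Fin (n + m) → ℝ) (hτ : τ ∈ OmegaU n (n + m))
    (hω : ω ∈ segment ℝ σ τ) (hωτ : ω ≠ τ)
    (mos mow : MonoOrder (n + m))
    (hEO : IsEO n mos I)
    (hσ : σ ∈ interior (gCone mos I)) (hint : ω ∈ interior (gCone mow I)) :
    (∀ Gσ Gω : Set (MvPolynomial (Fin (n + m)) K),
      IsRedGB mos I Gσ → IsRedGB mow I Gω →
        LXset n mow Gω = LXset n mos Gσ ∧ ∀ p ∈ LXset n mow Gω, inKX n p) ∧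
    IsEO n mow I := by
  have key : ∀ Gσ Gω : Set (MvPolynomial (Fin (n + m)) K),
      IsRedGB mos I Gσ → IsRedGB mow I Gω →
        LXset n mow Gω = LXset n mos Gσ ∧ ∀ p ∈ LXset n mow Gω, inKX n p := by
    intro Gσ Gω hGσ hGω
    have hX : ∀ p ∈ LXset n mos Gσ, inKX n p := fun p hp => hEO Gσ hGσ p hp.1 hp.2
    have heq := LXset_eq_of_segment_interior hτ hω hωτ hσ hint hGσ hGω hX
    exact ⟨heq, heq ▸ hX⟩
  refine ⟨key, fun Gω hGω g hg hgX => ?_⟩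
  obtain ⟨Gσ, hGσ⟩ := exists_isRedGB mos I
  exact (key Gσ Gω hGσ hGω).2 g ⟨hg, hgX⟩
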